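/- Fix integers m, n. In the polynomial ring ℂ[x,y,z] (MvPolynomial (Fin 3) ℂ), set β := x·y·z + 2 − y² − z², α := y·S_{m−1}(β) − (x·z − y)·S_{m−2}(β), and Q := (x·z − y)·S_{n−1}(α) − (S_m(β) − S_{m−1}(β))·S_{n−2}(α). Then the quotient ring ℂ[x,y,z] / ((x·y·z + 4 − x² − y² − z²)·Q) is a reduced ring; i.e., the universal character ring of the (−2,2m+1,2n)-pretzel link is reduced for all integers m and n. -/

import Mathlib

open Polynomial

/-- The normalized Chebyshev polynomials `S k` (`k : ℤ`), determined by
`S 0 = 1`, `S 1 = X`, and the recurrence `S (k + 1) = X * S k - S (k - 1)` for all `k : ℤ`. -/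
@[semireducible] noncomputable def chebS (R : Type*) [CommRing R] : ℤ → R[X]
  | 0 => 1
  | 1 => X
  | (n : ℕ) + 2 => X * chebS R (n + 1) - chebS R n
  | -((n : ℕ) + 1) => X * chebS R (-n) - chebS R (-n + 1)
  termination_by n => Int.natAbs n + Int.natAbs (n - 1)

/-- `β = x*y*z + 2 - y² - z²` in `ℂ[x,y,z]`, where `x, y, z` are the three variables. -/
noncomputable def beta3 : MvPolynomial (Fin 3) ℂ :=
  MvPolynomial.X 0 * MvPolynomial.X 1 * MvPolynomial.X 2 + 2
    - MvPolynomial.X 1 ^ 2 - MvPolynomial.X 2 ^ 2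

/-- `α = y * S (m-1) (β) - (x*z - y) * S (m-2) (β)` in `ℂ[x,y,z]`. -/
noncomputable def alpha3 (m : ℤ) : MvPolynomial (Fin 3) ℂ :=
  MvPolynomial.X 1 * (chebS (MvPolynomial (Fin 3) ℂ) (m - 1)).eval beta3
    - (MvPolynomial.X 0 * MvPolynomial.X 2 - MvPolynomial.X 1)
        * (chebS (MvPolynomial (Fin 3) ℂ) (m - 2)).eval beta3

/-- `Q = (x*z - y) * S (n-1) (α) - (S m (β) - S (m-1) (β)) * S (n-2) (α)` in `ℂ[x,y,z]`. -/
noncomputable def Q3 (m n : ℤ) : MvPolynomial (Fin 3) ℂ :=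
  (MvPolynomial.X 0 * MvPolynomial.X 2 - MvPolynomial.X 1)
      * (chebS (MvPolynomial (Fin 3) ℂ) (n - 1)).eval (alpha3 m)
    - ((chebS (MvPolynomial (Fin 3) ℂ) m).eval beta3
          - (chebS (MvPolynomial (Fin 3) ℂ) (m - 1)).eval beta3)
        * (chebS (MvPolynomial (Fin 3) ℂ) (n - 2)).eval (alpha3 m)

open Polynomial.Chebyshev (S S_add_one S_sub_one S_add_two S_sub_two)

lemma chebS_eq_S (R : Type*) [CommRing R] (k : ℤ) : chebS R k = S R k := by
  induction k using Polynomial.Chebyshev.induct with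
  | zero => simp [chebS]
  | one => simp [chebS]
  | add_two n h₁ h₀ =>
    rw [S_add_two, ← h₁, ← h₀]
    exact chebS.eq_3 R n
  | neg_add_one n h₀ h₁ =>
    rw [S_sub_one, ← h₀, ← h₁, show -(n : ℤ) - 1 = Int.negSucc n by omega]
    exact chebS.eq_4 R n

lemma map_eval_S {R A : Type*} [CommRing R] [CommRing A] (φ : R →+* A) (k : ℤ) (p : R) :
    φ ((S R k).eval p) = (S A k).eval (φ p) := by
  rw [← Polynomial.Chebyshev.map_S φ, eval_map, eval₂_hom]

lemma map_eval_derivative_S {R A : Type*} [CommRing R] [CommRing A] (φ : R →+* A) (k : ℤ) (p : R) :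
    φ ((derivative (S R k)).eval p) = (derivative (S A k)).eval (φ p) := by
  rw [← Polynomial.Chebyshev.map_S φ, derivative_map, eval_map, eval₂_hom]

lemma derivation_eval_S {K R : Type*} [CommRing K] [CommRing R] [Algebra K R]
    (D : Derivation K R R) (k : ℤ) (p : R) :
    D ((S R k).eval p) = (derivative (S R k)).eval p * D p := by
  induction k using Polynomial.Chebyshev.induct with
  | zero => simp
  | one => simp
  | add_two n h₁ h₀ =>
    simp only [S_add_two, eval_sub, eval_mul, eval_X, map_sub, Derivation.leibniz, smul_eq_mul,
      derivative_mul, derivative_X, eval_add, h₁, h₀, eval_one]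
    ring
  | neg_add_one n h₀ h₁ =>
    simp only [S_sub_one, eval_sub, eval_mul, eval_X, map_sub, Derivation.leibniz, smul_eq_mul,
      derivative_mul, derivative_X, eval_add, h₁, h₀, eval_one]
    ring

lemma sq_sub_four_mul_derivative_S (R : Type*) [CommRing R] (k : ℤ) :
    (X ^ 2 - 4) * derivative (S R k) = (k : R[X]) * X * S R k - 2 * ((k : R[X]) + 1) * S R (k - 1) := by
  induction k using Polynomial.Chebyshev.induct with
  | zero => simp
  | one => simp; ring
  | add_two n h₁ h₀ =>
    have e₀ := S_sub_one R n
    have e₁ : S R ((n : ℤ) + 1 - 1) = S R n := by congr 1; ring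
    have e₂ : S R ((n : ℤ) + 2 - 1) = S R (n + 1) := by congr 1; ring
    simp only [S_add_two, derivative_sub, derivative_mul, derivative_X, e₁, e₂, e₀] at *
    push_cast at *
    linear_combination X * h₁ - h₀
  | neg_add_one n h₀ h₁ =>
    have e₁ : S R (-(n : ℤ) + 1 - 1) = S R (-n) := by congr 1; ring
    have e₂ : S R (-(n : ℤ) - 1 - 1) = X * S R (-n - 1) - S R (-n) := by
      rw [show -(n : ℤ) - 1 - 1 = -n - 2 by ring, S_sub_two]
    rw [e₂]
    rw [e₁] at h₁
    simp only [S_sub_one R (-n), derivative_sub, derivative_mul, derivative_X] at *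
    push_cast at *
    linear_combination X * h₀ - h₁

section Domain

variable {A : Type*} [CommRing A]

lemma eval_S_eq (k : ℤ) (t : A) :
    (S A k).eval t = t * (S A (k - 1)).eval t - (S A (k - 2)).eval t := by
  rw [Polynomial.Chebyshev.S_eq]; simp

lemma eval_derivative_S_eq (k : ℤ) (t : A) :
    (derivative (S A k)).eval t = (S A (k - 1)).eval t + t * (derivative (S A (k - 1))).eval t
      - (derivative (S A (k - 2))).eval t := by
  rw [Polynomial.Chebyshev.S_eq]; simp

lemma eval_S_sq_add (k : ℤ) (t : A) :
    (S A k).eval t ^ 2 + (S A (k - 1)).eval t ^ 2 - t * (S A k).eval t * (S A (k - 1)).eval t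
      = 1 := by
  have h := congrArg (eval t) (Polynomial.Chebyshev.S_sq_add_S_sq A (k - 1))
  simp only [sub_add_cancel, eval_sub, eval_add, eval_mul, eval_pow, eval_X, eval_one] at h
  linear_combination h

lemma eval_sq_sub_four_mul_derivative_S (k : ℤ) (t : A) :
    (t ^ 2 - 4) * (derivative (S A k)).eval t
      = k * t * (S A k).eval t - 2 * (k + 1) * (S A (k - 1)).eval t := by
  simpa using congrArg (eval t) (sq_sub_four_mul_derivative_S A k)

/-- `S k - S (k - 1)` has no multiple roots. -/
lemma eval_derivative_S_sub_ne_zero [CharZero A] (k : ℤ) {t : A}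
    (h : (S A k).eval t - (S A (k - 1)).eval t = 0) :
    (derivative (S A k)).eval t - (derivative (S A (k - 1))).eval t ≠ 0 := by
  intro h'
  have h₁ := eval_sq_sub_four_mul_derivative_S k t
  have h₂ := eval_sq_sub_four_mul_derivative_S (k - 1) t
  have h₃ := eval_S_sq_add k t
  have h₄ := eval_S_eq k t
  rw [sub_sub, one_add_one_eq_two] at h₂
  push_cast at h₂
  have e : (S A k).eval t = (S A (k - 1)).eval t := sub_eq_zero.1 h
  rw [e] at h₁ h₃ h₄
  generalize (S A (k - 1)).eval t = s at *
  have hk : (2 * (k : A) + 1) ≠ 0 := by exact_mod_cast (by omega : 2 * k + 1 ≠ 0)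
  refine hk ?_
  have h₅ : (2 * (k : A) + 1) * ((t - 2) * s) = 0 := by
    linear_combination (t ^ 2 - 4) * h' - h₁ + h₂ - 2 * k * h₄
  linear_combination (-s) * h₅ - (2 * (k : A) + 1) * h₃

variable [IsDomain A] [CharZero A]

/-- `S k` has no multiple roots unless it is zero. -/
lemma eval_derivative_S_ne_zero {k : ℤ} (hk : k ≠ -1) {t : A} (h : (S A k).eval t = 0) :
    (derivative (S A k)).eval t ≠ 0 := by
  intro h'
  have h₁ := eval_sq_sub_four_mul_derivative_S k t
  have h₂ := eval_S_sq_add k t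
  rw [h, h'] at h₁
  rw [h] at h₂
  have hk' : (2 * ((k : A) + 1)) ≠ 0 :=
    mul_ne_zero two_ne_zero (by exact_mod_cast fun h : k + 1 = 0 => hk (by omega))
  have h₃ : (S A (k - 1)).eval t = 0 := by
    refine (mul_eq_zero.1 ?_).resolve_left hk'
    linear_combination h₁
  simp [h₃] at h₂

/-- Where `w * S (n - 1) (a) - (S m (b) - S (m - 1) (b)) * S (n - 2) (a)`, with
`a = y * S (m - 1) (b) - w * S (m - 2) (b)`, vanishes together with its partial derivatives
in `y`, `w` and `b`. -/
lemma singular_points {m n : ℤ} (hmn : n = -1 → m ≠ 0) {y w b a : A}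
    (ha : a = y * (S A (m - 1)).eval b - w * (S A (m - 2)).eval b)
    (hG : w * (S A (n - 1)).eval a
      - ((S A m).eval b - (S A (m - 1)).eval b) * (S A (n - 2)).eval a = 0)
    {T : A} (hT : T = w * (derivative (S A (n - 1))).eval a
      - ((S A m).eval b - (S A (m - 1)).eval b) * (derivative (S A (n - 2))).eval a)
    (hy : (S A (m - 1)).eval b * T = 0)
    (hw : (S A (n - 1)).eval a - (S A (m - 2)).eval b * T = 0)
    (hb : (y * (derivative (S A (m - 1))).eval b - w * (derivative (S A (m - 2))).eval b) * T
      - ((derivative (S A m)).eval b - (derivative (S A (m - 1))).eval b)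
        * (S A (n - 2)).eval a = 0) :
    (w = 0 ∧ (S A m).eval b - (S A (m - 1)).eval b = 0) ∨
      (m ≠ 0 ∧ y = w ∧ (S A (m - 1)).eval b = 0) := by
  have hrec := eval_S_eq m b
  have hsq := eval_S_sq_add m b
  by_cases h₀ : (S A (m - 1)).eval b = 0
  · rw [h₀] at ha hG hT hrec hsq
    rw [mul_zero, zero_sub] at hrec
    have hc : (S A (m - 2)).eval b ^ 2 = 1 := by
      rw [hrec] at hsq; linear_combination hsq
    rw [hrec] at hG hT
    by_cases hn : n = -1
    · subst hn
      have hm := hmn rfl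
      refine Or.inr ⟨hm, ?_, h₀⟩
      have hd := eval_derivative_S_ne_zero (by omega) h₀
      have e₁ := eval_derivative_S_eq m b
      have e₂ := congrArg (fun p => eval b (derivative p))
        (Polynomial.Chebyshev.S_sq_add_S_sq A (m - 2))
      rw [show m - 2 + 1 = m - 1 by ring] at e₂
      simp only [derivative_sub, derivative_add, derivative_pow, derivative_mul, derivative_X,
        derivative_one, eval_sub, eval_add, eval_mul, eval_pow, eval_X, eval_one, eval_zero,
        eval_natCast, map_natCast, h₀] at e₂
      norm_num at e₂
      have e₃ : S A (-3) = -X := by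
        simpa using Polynomial.Chebyshev.S_neg_sub_two A 1
      norm_num [e₃] at hT hb
      rw [h₀] at e₁
      refine mul_right_cancel₀ hd (sub_eq_zero.1 ?_)
      generalize (S A (m - 2)).eval b = s at *
      generalize (derivative (S A (m - 2))).eval b = s' at *
      generalize (derivative (S A (m - 1))).eval b = r at *
      generalize (derivative (S A m)).eval b = q at *
      subst hT ha e₁
      linear_combination (-s) * hb + w * s * e₂ + (w * r - y * r) * hc
    · exfalso
      have hw' : w = -(S A (m - 2)).eval b * a := by rw [ha]; linear_combination (-w) * hc
      have h₁ : (S A n).eval a = 0 := by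
        rw [eval_S_eq]
        linear_combination (-(S A (m - 2)).eval b) * hG
          + (S A (m - 2)).eval b * (S A (n - 1)).eval a * hw'
          - (a * (S A (n - 1)).eval a - (S A (n - 2)).eval a) * hc
      refine eval_derivative_S_ne_zero hn h₁ ?_
      rw [eval_derivative_S_eq]
      linear_combination hw + (S A (m - 2)).eval b * hT
          + (S A (m - 2)).eval b * (derivative (S A (n - 1))).eval a * hw'
          - (a * (derivative (S A (n - 1))).eval a - (derivative (S A (n - 2))).eval a) * hc
  · left
    have hT₀ : T = 0 := (mul_eq_zero.1 hy).resolve_left h₀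
    have h₁ : (S A (n - 1)).eval a = 0 := by linear_combination hw + (S A (m - 2)).eval b * hT₀
    have hne : (S A (n - 2)).eval a ≠ 0 := by
      intro h
      have := eval_S_sq_add (n - 1) a
      rw [sub_sub, one_add_one_eq_two, h, h₁] at this
      simp at this
    have hc : (S A m).eval b - (S A (m - 1)).eval b = 0 :=
      (mul_eq_zero.1 (by linear_combination w * h₁ - hG)).resolve_right hne
    refine ⟨?_, hc⟩
    rw [hc, hT₀] at hT
    by_cases hn : n = 0
    · exfalso
      rw [hT₀] at hb
      exact eval_derivative_S_sub_ne_zero m hc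
        ((mul_eq_zero.1 (by linear_combination -hb)).resolve_right hne)
    · exact (mul_eq_zero.1 (by linear_combination -hT)).resolve_right
        (eval_derivative_S_ne_zero (by omega) h₁)

end Domain

section Link

local notation "R₃" => MvPolynomial (Fin 3) ℂ
local notation "x₀" => (MvPolynomial.X 0 : MvPolynomial (Fin 3) ℂ)
local notation "y₀" => (MvPolynomial.X 1 : MvPolynomial (Fin 3) ℂ)
local notation "z₀" => (MvPolynomial.X 2 : MvPolynomial (Fin 3) ℂ)

variable {A : Type*} [CommRing A]

lemma map_beta3 (φ : R₃ →+* A) :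
    φ beta3 = φ x₀ * φ y₀ * φ z₀ + 2 - φ y₀ ^ 2 - φ z₀ ^ 2 := by
  simp [beta3, map_ofNat]

lemma map_alpha3 (φ : R₃ →+* A) (m : ℤ) :
    φ (alpha3 m) = φ y₀ * (S A (m - 1)).eval (φ beta3)
      - (φ x₀ * φ z₀ - φ y₀) * (S A (m - 2)).eval (φ beta3) := by
  simp [alpha3, chebS_eq_S, map_eval_S]

lemma map_Q3 (φ : R₃ →+* A) (m n : ℤ) :
    φ (Q3 m n) = (φ x₀ * φ z₀ - φ y₀) * (S A (n - 1)).eval (φ (alpha3 m))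
      - ((S A m).eval (φ beta3) - (S A (m - 1)).eval (φ beta3))
        * (S A (n - 2)).eval (φ (alpha3 m)) := by
  simp [Q3, chebS_eq_S, map_eval_S]

/-- The chain rule for `Q3`, viewed as a function of `y`, `x * z - y` and `beta3`. -/
lemma derivation_Q3 (φ : R₃ →+* A) (D : Derivation ℂ R₃ R₃) (m n : ℤ) {T : A}
    (hT : T = (φ x₀ * φ z₀ - φ y₀) * (derivative (S A (n - 1))).eval (φ (alpha3 m))
      - ((S A m).eval (φ beta3) - (S A (m - 1)).eval (φ beta3))
        * (derivative (S A (n - 2))).eval (φ (alpha3 m))) :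
    φ (D (Q3 m n)) = (S A (m - 1)).eval (φ beta3) * T * φ (D y₀)
      + ((S A (n - 1)).eval (φ (alpha3 m)) - (S A (m - 2)).eval (φ beta3) * T)
        * φ (D (x₀ * z₀ - y₀))
      + ((φ y₀ * (derivative (S A (m - 1))).eval (φ beta3)
            - (φ x₀ * φ z₀ - φ y₀) * (derivative (S A (m - 2))).eval (φ beta3)) * T
          - ((derivative (S A m)).eval (φ beta3) - (derivative (S A (m - 1))).eval (φ beta3))
            * (S A (n - 2)).eval (φ (alpha3 m))) * φ (D beta3) := by
  have hα : φ (D (alpha3 m)) = (S A (m - 1)).eval (φ beta3) * φ (D y₀)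
      - (S A (m - 2)).eval (φ beta3) * φ (D (x₀ * z₀ - y₀))
      + (φ y₀ * (derivative (S A (m - 1))).eval (φ beta3)
            - (φ x₀ * φ z₀ - φ y₀) * (derivative (S A (m - 2))).eval (φ beta3)) * φ (D beta3) := by
    rw [alpha3, chebS_eq_S, chebS_eq_S, map_sub, Derivation.leibniz, Derivation.leibniz]
    simp only [derivation_eval_S, smul_eq_mul, map_sub, map_add, map_mul, map_eval_S,
      map_eval_derivative_S]
    ring
  rw [Q3]
  simp only [chebS_eq_S]
  rw [map_sub, Derivation.leibniz, Derivation.leibniz]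
  simp only [derivation_eval_S, smul_eq_mul, map_sub, map_add, map_mul, map_eval_S,
      map_eval_derivative_S, hα, hT]
  ring

lemma derivation_beta3 (D : Derivation ℂ R₃ R₃) :
    D beta3 = (x₀ * z₀ - y₀) * D y₀ + y₀ * D (x₀ * z₀ - y₀) - 2 * z₀ * D z₀ := by
  have h : D 2 = 0 := by simpa using D.map_natCast 2
  simp [beta3, h]
  ring

lemma irreducible_C_mul_y_sub (c : ℂ) (hc : c ≠ 0) :
    Irreducible (MvPolynomial.C c * y₀ + -(x₀ * z₀)) := by
  have hv : 1 ∉ (-(x₀ * z₀)).vars := by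
    rw [MvPolynomial.vars_neg]
    intro h
    have := MvPolynomial.vars_mul _ _ h
    simp [MvPolynomial.vars_X] at this
  refine MvPolynomial.irreducible_mul_X_add _ _ _ ?_ (by simp) hv ?_
  · simpa using hc
  · exact ((isUnit_iff_ne_zero.2 hc).map MvPolynomial.C).isRelPrime_left

lemma eval_Q3_two (m n : ℤ) : MvPolynomial.eval ![2, 2, 2] (Q3 m n) = n + 1 := by
  have hb : MvPolynomial.eval (![2, 2, 2] : Fin 3 → ℂ) beta3 = 2 := by
    rw [map_beta3]; simp; norm_num
  have ha : MvPolynomial.eval (![2, 2, 2] : Fin 3 → ℂ) (alpha3 m) = 2 := by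
    rw [map_alpha3, hb]; simp; ring
  rw [map_Q3, ha, hb]; simp; ring

lemma eval_Q3_zero_two_zero_ne_zero {m n : ℤ} (h : (2 * m - 1) * (n - 1) ≠ 2) :
    MvPolynomial.eval ![0, 2, 0] (Q3 m n) ≠ 0 := by
  have h' : ((2 * m - 1) * (n - 1) - 2 : ℂ) ≠ 0 := by
    exact_mod_cast sub_ne_zero.2 h
  have hb : MvPolynomial.eval (![0, 2, 0] : Fin 3 → ℂ) beta3 = -2 := by
    rw [map_beta3]; simp; norm_num
  have hα := map_alpha3 (MvPolynomial.eval (![0, 2, 0] : Fin 3 → ℂ)) m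
  rw [map_Q3]
  rw [hb] at hα ⊢
  simp only [Polynomial.Chebyshev.S_eval_neg_two, Int.negOnePow_sub] at hα ⊢
  rcases Int.even_or_odd m with hm | hm
  · simp [Int.negOnePow_even _ hm, Int.negOnePow_even 2 even_two] at hα
    replace hα : MvPolynomial.eval (![0, 2, 0] : Fin 3 → ℂ) (alpha3 m) = -2 := by
      rw [hα]; ring
    rw [hα]
    rcases Int.even_or_odd n with hn | hn <;>
    simp [Int.negOnePow_even _ hm, Int.negOnePow_even, Int.negOnePow_odd, hn] <;>
    contrapose! h' <;> first | linear_combination h' | linear_combination -h'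
  · simp [Int.negOnePow_odd _ hm, Int.negOnePow_even 2 even_two] at hα
    replace hα : MvPolynomial.eval (![0, 2, 0] : Fin 3 → ℂ) (alpha3 m) = 2 := by
      rw [hα]; ring
    rw [hα]
    simp [Int.negOnePow_odd _ hm]
    contrapose! h'
    linear_combination h'

lemma eval_Q3_neg_one (m : ℤ) (t : ℂ) :
    MvPolynomial.eval ![t, t, 2] (Q3 m (-1))
      = (S ℂ (m - 1)).eval (t ^ 2 - 2) ^ 2 * (t ^ 2 - 4) * t := by
  have hb : MvPolynomial.eval (![t, t, 2] : Fin 3 → ℂ) beta3 = t ^ 2 - 2 := by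
    rw [map_beta3]; simp; ring
  have e₃ : S ℂ (-3) = -X := by simpa using Polynomial.Chebyshev.S_neg_sub_two ℂ 1
  have h₁ := eval_S_sq_add m (t ^ 2 - 2)
  have h₂ := eval_S_eq m (t ^ 2 - 2)
  have hz : (![t, t, 2] : Fin 3 → ℂ) 2 = 2 := rfl
  rw [map_Q3, map_alpha3, hb]
  norm_num [e₃, hz]
  generalize (S ℂ (m - 1)).eval (t ^ 2 - 2) = a at *
  generalize (S ℂ (m - 2)).eval (t ^ 2 - 2) = b at *
  rw [h₂] at h₁ ⊢
  linear_combination t * h₁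

lemma Q3_one_three : Q3 1 3 = z₀ * (y₀ * z₀ - x₀) := by
  simp [Q3, alpha3, beta3, chebS_eq_S, Polynomial.Chebyshev.S_two]
  ring

lemma irreducible_markov_cubic : Irreducible (x₀ * y₀ * z₀ + 4 - x₀ ^ 2 - y₀ ^ 2 - z₀ ^ 2) := by
  let u : MvPolynomial (Fin 2) ℂ := MvPolynomial.X 0
  let v : MvPolynomial (Fin 2) ℂ := MvPolynomial.X 1
  let q : (MvPolynomial (Fin 2) ℂ)[X] := X ^ 2 - C (u * v) * X + C (u ^ 2 + v ^ 2 - 4)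
  have he : MvPolynomial.finSuccEquiv ℂ 2 (x₀ * y₀ * z₀ + 4 - x₀ ^ 2 - y₀ ^ 2 - z₀ ^ 2) = -q := by
    have h₁ : MvPolynomial.finSuccEquiv ℂ 2 y₀ = C u := MvPolynomial.finSuccEquiv_X_succ (j := 0)
    have h₂ : MvPolynomial.finSuccEquiv ℂ 2 z₀ = C v := MvPolynomial.finSuccEquiv_X_succ (j := 1)
    have h₄ : MvPolynomial.finSuccEquiv ℂ 2 4 = 4 := map_ofNat _ 4
    have h₅ : (C 4 : (MvPolynomial (Fin 2) ℂ)[X]) = 4 := map_ofNat _ 4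
    simp only [map_sub, map_add, map_mul, map_pow, h₁, h₂, h₄, h₅,
      MvPolynomial.finSuccEquiv_X_zero, q]
    ring
  rw [← MulEquiv.irreducible_iff (MvPolynomial.finSuccEquiv ℂ 2), he,
    (Associated.refl q).neg_left.irreducible_iff]
  have hdeg : q.natDegree = 2 := by simp only [q]; compute_degree!
  have hmonic : q.Monic := by simp only [q]; monicity!
  rw [hmonic.irreducible_iff_roots_eq_zero_of_degree_le_three (by omega) (by omega),
    Multiset.eq_zero_iff_forall_notMem]
  intro r hr
  have hroot : r ^ 2 - u * v * r + (u ^ 2 + v ^ 2 - 4) = 0 := by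
    simpa [q, IsRoot] using isRoot_of_mem_roots hr
  have h4 : MvPolynomial.pderiv (0 : Fin 2) (4 : MvPolynomial (Fin 2) ℂ) = 0 := by
    simpa using (MvPolynomial.pderiv (R := ℂ) (0 : Fin 2)).map_natCast 4
  have h₀ := congrArg (MvPolynomial.eval ![2, 0]) hroot
  have h₁ := congrArg (fun p => MvPolynomial.eval ![2, 0] (MvPolynomial.pderiv 0 p)) hroot
  simp [u, v, h4, MvPolynomial.pderiv_X] at h₀ h₁
  have h₂ : MvPolynomial.eval ![2, 0] r = 0 := by
    rw [← pow_eq_zero_iff two_ne_zero]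
    linear_combination h₀
  norm_num [h₂] at h₁

/-- No irreducible polynomial other than `z` occurs in `Q3` with multiplicity. For such a factor,
all partial derivatives with respect to `y`, `x * z - y` and `beta3` would vanish modulo it. -/
lemma not_sq_dvd_Q3_of_not_dvd {m n : ℤ} (hmn : n = -1 → m ≠ 0) {f : R₃} (hf : Irreducible f)
    (hz : ¬ f ∣ z₀) : ¬ f * f ∣ Q3 m n := by
  rintro ⟨g, hg⟩
  have hp : (Ideal.span {f}).IsPrime :=
    (Ideal.span_singleton_prime hf.ne_zero).2 hf.prime
  let φ : R₃ →+* R₃ ⧸ Ideal.span {f} := Ideal.Quotient.mk _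
  have hφ (p : R₃) : φ p = 0 ↔ f ∣ p := by
    rw [Ideal.Quotient.eq_zero_iff_mem, Ideal.mem_span_singleton]
  have hf₀ : φ f = 0 := (hφ f).2 dvd_rfl
  have hD (D : Derivation ℂ R₃ R₃) : φ (D (Q3 m n)) = 0 := by
    simp [hg, hf₀]
  have hchar : CharZero (R₃ ⧸ Ideal.span {f}) := algebraRat.charZero _
  have hz' : φ z₀ ≠ 0 := fun h => hz ((hφ _).1 h)
  obtain ⟨T, hT⟩ : ∃ T, T = _ := ⟨_, rfl⟩
  have hx := derivation_Q3 φ (MvPolynomial.pderiv 0) m n hT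
  have hy := derivation_Q3 φ (MvPolynomial.pderiv 1) m n hT
  have hzz := derivation_Q3 φ (MvPolynomial.pderiv 2) m n hT
  have hQ := map_Q3 φ m n
  have hα := map_alpha3 φ m
  rw [hD] at hx hy hzz
  rw [hg, map_mul, map_mul, hf₀, zero_mul, zero_mul] at hQ
  have key := singular_points hmn hα hQ.symm hT
  rw [derivation_beta3] at hx hy hzz
  simp only [map_sub, map_add, map_mul, Derivation.leibniz, smul_eq_mul, MvPolynomial.pderiv_X,
    Pi.single_apply, map_one, map_zero, map_ofNat, Fin.reduceEq, if_true, if_false] at hx hy hzz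
  generalize (S (R₃ ⧸ Ideal.span {f}) (m - 1)).eval (φ beta3) * T = Gy at *
  generalize (S (R₃ ⧸ Ideal.span {f}) (n - 1)).eval (φ (alpha3 m))
    - (S (R₃ ⧸ Ideal.span {f}) (m - 2)).eval (φ beta3) * T = Gw at *
  generalize (φ y₀ * (derivative (S (R₃ ⧸ Ideal.span {f}) (m - 1))).eval (φ beta3)
            - (φ x₀ * φ z₀ - φ y₀)
              * (derivative (S (R₃ ⧸ Ideal.span {f}) (m - 2))).eval (φ beta3)) * T
          - ((derivative (S (R₃ ⧸ Ideal.span {f}) m)).eval (φ beta3)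
              - (derivative (S (R₃ ⧸ Ideal.span {f}) (m - 1))).eval (φ beta3))
            * (S (R₃ ⧸ Ideal.span {f}) (n - 2)).eval (φ (alpha3 m)) = Gb at *
  have h₁ : Gw + φ y₀ * Gb = 0 :=
    (mul_eq_zero.1 (by linear_combination -hx)).resolve_left hz'
  have hGb : Gb = 0 :=
    (mul_eq_zero.1 (by linear_combination hzz + φ x₀ * h₁)).resolve_left
      (mul_ne_zero two_ne_zero hz')
  have hGw : Gw = 0 := by linear_combination h₁ - φ y₀ * hGb
  have hGy : Gy = 0 := by
    linear_combination -hy + hGw - (φ x₀ * φ z₀ - 2 * φ y₀) * hGb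
  rcases key hGy hGw hGb with ⟨hw, hc⟩ | ⟨hm, hw, ha⟩
  · rw [← map_mul, ← map_sub, hφ] at hw
    simp only [← map_eval_S] at hc
    rw [← map_sub, hφ] at hc
    have hi := irreducible_C_mul_y_sub 1 one_ne_zero
    have hd : f ∣ MvPolynomial.C 1 * y₀ + -(x₀ * z₀) := by
      rw [← dvd_neg]; simpa [sub_eq_add_neg] using hw
    obtain ⟨k, hk⟩ := (hf.associated_of_dvd hi hd).symm.dvd.trans hc
    have := congrArg (MvPolynomial.eval ![0, 0, 0]) hk
    rw [map_sub, map_eval_S, map_eval_S, map_beta3] at this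
    simp at this
  · rw [← sub_eq_zero, ← map_mul, ← map_sub, ← map_sub, hφ] at hw
    rw [← map_eval_S, hφ] at ha
    have hi := irreducible_C_mul_y_sub 2 two_ne_zero
    have hd : f ∣ MvPolynomial.C 2 * y₀ + -(x₀ * z₀) := by
      convert hw using 1
      rw [map_ofNat]
      ring
    obtain ⟨k, hk⟩ := (hf.associated_of_dvd hi hd).symm.dvd.trans ha
    have := congrArg (MvPolynomial.eval ![0, 0, 0]) hk
    rw [map_eval_S, map_beta3] at this
    simp [hm] at this

lemma squarefree_Q3 {m n : ℤ} (hmn : n = -1 → m ≠ 0) (h₀ : Q3 m n ≠ 0) :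
    Squarefree (Q3 m n) := by
  rw [squarefree_iff_no_irreducibles h₀]
  intro f hf hff
  refine not_sq_dvd_Q3_of_not_dvd hmn hf (fun hz => ?_) hff
  have hzi : Irreducible z₀ := MvPolynomial.X_prime.irreducible
  have hzf : z₀ ∣ f := (hf.associated_of_dvd hzi hz).symm.dvd
  have hzz : z₀ * z₀ ∣ Q3 m n := (mul_dvd_mul hzf hzf).trans hff
  by_cases h : (2 * m - 1) * (n - 1) = 2
  · have hm : 2 * m - 1 ∣ 2 := Dvd.intro _ h
    have h₁ := Int.le_of_dvd two_pos hm
    have h₂ := Int.le_of_dvd two_pos ((neg_dvd).2 hm)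
    obtain rfl | rfl : m = 0 ∨ m = 1 := by omega
    all_goals clear hm h₁ h₂
    · exact hmn (by omega) rfl
    · obtain rfl : n = 3 := by omega
      rw [Q3_one_three] at hzz
      obtain ⟨g, hg⟩ := (mul_dvd_mul_iff_left hzi.ne_zero).1 hzz
      simpa using congrArg (MvPolynomial.eval ![1, 0, 0]) hg
  · obtain ⟨g, hg⟩ := hzz
    apply eval_Q3_zero_two_zero_ne_zero h
    simp [hg]

lemma exists_eval_Q3_ne_zero {m n : ℤ} (hmn : n = -1 → m ≠ 0) :
    ∃ v : Fin 3 → ℂ, MvPolynomial.eval v (x₀ * y₀ * z₀ + 4 - x₀ ^ 2 - y₀ ^ 2 - z₀ ^ 2) = 0 ∧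
      MvPolynomial.eval v (Q3 m n) ≠ 0 := by
  by_cases hn : n = -1
  · have hm := hmn hn
    have hS : S ℂ (m - 1) ≠ 0 := by
      intro h
      have := Polynomial.Chebyshev.S_eval_two ℂ (m - 1)
      simp [h] at this
      exact hm (by exact_mod_cast this.symm)
    have hne : S ℂ (m - 1) * (X - C 2) * (X + C 2) ≠ 0 :=
      mul_ne_zero (mul_ne_zero hS (X_sub_C_ne_zero 2)) (X_add_C_ne_zero 2)
    obtain ⟨b, hb⟩ : ∃ b, (S ℂ (m - 1) * (X - C 2) * (X + C 2)).eval b ≠ 0 := by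
      by_contra! h
      exact hne (Polynomial.funext (by simpa using h))
    obtain ⟨t, ht⟩ := IsAlgClosed.exists_eq_mul_self (b + 2)
    obtain rfl : b = t ^ 2 - 2 := by linear_combination ht
    subst hn
    refine ⟨![t, t, 2], by simp; ring, ?_⟩
    rw [eval_Q3_neg_one]
    contrapose! hb
    simp only [eval_mul, eval_sub, eval_add, eval_X, eval_C]
    rcases mul_eq_zero.1 hb with h | h
    · rcases mul_eq_zero.1 h with h | h
      · rw [pow_eq_zero_iff two_ne_zero] at h
        simp [h]
      · linear_combination (S ℂ (m - 1)).eval (t ^ 2 - 2) * t ^ 2 * h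
    · simp [h]
  · refine ⟨![2, 2, 2], by simp; norm_num, ?_⟩
    rw [eval_Q3_two]
    exact_mod_cast fun h : n + 1 = 0 => hn (by omega)

lemma Q3_zero_neg_one : Q3 0 (-1) = 0 := by
  have e₃ : S R₃ (-3) = -X := by simpa using Polynomial.Chebyshev.S_neg_sub_two R₃ 1
  simp [Q3, alpha3, chebS_eq_S, e₃]

end Link

/-- The universal character ring of the `(-2, 2m+1, 2n)`-pretzel link, i.e. the quotient of
`ℂ[x,y,z]` by the principal ideal generated by `(x*y*z + 4 - x² - y² - z²) * Q`, is reduced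
for all integers `m` and `n`. -/
theorem universal_character_ring_reduced (m n : ℤ) :
    IsReduced (MvPolynomial (Fin 3) ℂ ⧸
      Ideal.span {(MvPolynomial.X 0 * MvPolynomial.X 1 * MvPolynomial.X 2 + 4
          - MvPolynomial.X 0 ^ 2 - MvPolynomial.X 1 ^ 2 - MvPolynomial.X 2 ^ 2) * Q3 m n}) := by
  rw [← Ideal.isRadical_iff_quotient_reduced, ← isRadical_iff_span_singleton,
    isRadical_iff_squarefree_or_zero]
  by_cases hmn : n = -1 ∧ m = 0
  · obtain ⟨rfl, rfl⟩ := hmn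
    simp [Q3_zero_neg_one]
  · have hmn' : n = -1 → m ≠ 0 := fun hn hm => hmn ⟨hn, hm⟩
    obtain ⟨v, hv, hQ⟩ := exists_eval_Q3_ne_zero hmn'
    left
    rw [squarefree_mul_iff]
    refine ⟨?_, irreducible_markov_cubic.squarefree, squarefree_Q3 hmn' fun h => hQ (by simp [h])⟩
    rw [irreducible_markov_cubic.isRelPrime_iff_not_dvd]
    rintro ⟨g, hg⟩
    exact hQ (by rw [hg, map_mul, hv, zero_mul])
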